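/- arXiv:2102.08670 — 3 statements merged into one kernel-verified Lean document; each statement's English description precedes it below -/
import Mathlib

section
/- Let (i,j,p) be a decreasing run in a string S of length n. Then there is exactly one index i0 ∈ [i, i+p) such that λ[i0] = p. -/
open List

variable {α : Type*} [LinearOrder α]

/-- The substring `S[i..j]` (1-based, both endpoints inclusive). -/
def sub (S : ℕ → α) (i j : ℕ) : List α := (List.range' i (j + 1 - i)).map S

/-- The suffix `S_i = S[i..n]` (empty for `i = n + 1`). -/
def suf (S : ℕ → α) (n i : ℕ) : List α := sub S i n

/-- The prefix `S[1..i]`. -/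
def pre (S : ℕ → α) (i : ℕ) : List α := sub S 1 i

/-- Strict lexicographic order `≺` on strings. -/
def slt (l₁ l₂ : List α) : Prop := List.Lex (· < ·) l₁ l₂

/-- Length of the longest common prefix of two lists. -/
def lcpLen (l₁ l₂ : List α) : ℕ :=
  Nat.findGreatest (fun k => l₁.take k = l₂.take k) (min l₁.length l₂.length)

/-- `rlce S n i j` : length of the longest common prefix of suffixes `S_i` and `S_j`. -/
def rlce (S : ℕ → α) (n i j : ℕ) : ℕ := lcpLen (suf S n i) (suf S n j)

/-- `llce S i j` : length of the longest common suffix of prefixes `S[1..i]` and `S[1..j]`. -/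
def llce (S : ℕ → α) (i j : ℕ) : ℕ := lcpLen (pre S i).reverse (pre S j).reverse

/-- Next-smaller-suffix array: `nss S n i = min { j | j = n+1 ∨ (i < j ≤ n ∧ S_j ≺ S_i) }`. -/
noncomputable def nss (S : ℕ → α) (n i : ℕ) : ℕ :=
  sInf {j | j = n + 1 ∨ (i < j ∧ j ≤ n ∧ slt (suf S n j) (suf S n i))}

/-- A Lyndon word: nonempty and strictly smaller than each of its non-trivial cyclic shifts. -/
def IsLyndon (l : List α) : Prop :=
  l ≠ [] ∧ ∀ k, 0 < k → k < l.length → slt l (l.drop k ++ l.take k)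

/-- The Lyndon array: `lyn S n i = max { j - i + 1 | i ≤ j ≤ n, S[i..j] is a Lyndon word }`. -/
noncomputable def lyn (S : ℕ → α) (n i : ℕ) : ℕ :=
  sSup {m | ∃ j, i ≤ j ∧ j ≤ n ∧ IsLyndon (sub S i j) ∧ m = j - i + 1}

/-- `p ≥ 1` is a period of `S[i..j]`: `S[x] = S[x+p]` for all `x ∈ [i, j - p]`. -/
def IsPeriod (S : ℕ → α) (i j p : ℕ) : Prop :=
  1 ≤ p ∧ ∀ x, i ≤ x → x + p ≤ j → S x = S (x + p)

/-- A run `(i,j,p)` in a string of length `n`. -/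
def IsRun (S : ℕ → α) (n i j p : ℕ) : Prop :=
  1 ≤ i ∧ i ≤ j ∧ j ≤ n ∧
  IsPeriod S i j p ∧ (∀ q, 1 ≤ q → q < p → ¬ IsPeriod S i j q) ∧
  2 * p ≤ j - i + 1 ∧
  (1 < i → ¬ IsPeriod S (i - 1) j p) ∧
  (j < n → ¬ IsPeriod S i (j + 1) p)

/-- A (lexicographically) decreasing run: a run with `S_i ≻ S_{i+p}`. -/
def IsDecRun (S : ℕ → α) (n i j p : ℕ) : Prop :=
  IsRun S n i j p ∧ slt (suf S n (i + p)) (suf S n i)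

theorem List.append_lt_append_left_iff (c a b : List α) : c ++ a < c ++ b ↔ a < b := by
  induction c with
  | nil => rfl
  | cons x c ih => simpa [List.cons_lt_cons_iff] using ih

theorem List.append_lt_append_of_lt_of_length_eq {a b : List α} (h : a < b)
    (hl : a.length = b.length) (x y : List α) : a ++ x < b ++ y := by
  induction a generalizing b with
  | nil => cases b <;> simp_all
  | cons u a ih =>
    cases b with
    | nil => simp at hl
    | cons v b =>
      simp only [List.cons_append, List.cons_lt_cons_iff] at h ⊢
      rcases h with h | ⟨h, h'⟩
      · exact Or.inl h
      · exact Or.inr ⟨h, ih h' (by simpa using hl)⟩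

section Substring

variable {β : Type*} {S : ℕ → β} {n i j p : ℕ}

@[simp]
theorem length_sub (S : ℕ → β) (a b : ℕ) : (sub S a b).length = b + 1 - a := by
  simp [sub]

@[simp]
theorem getElem_sub (S : ℕ → β) (a b t : ℕ) (h : t < (sub S a b).length) :
    (sub S a b)[t] = S (a + t) := by
  simp [sub]

theorem sub_eq_append (S : ℕ → β) {a m b : ℕ} (h₁ : a < m) (h₂ : m ≤ b + 1) :
    sub S a b = sub S a (m - 1) ++ sub S m b := by
  apply List.ext_getElem
  · simp
    omega
  · intro t _ _
    rw [List.getElem_append]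
    simp only [getElem_sub, length_sub]
    split_ifs
    · rfl
    · congr 1
      omega

theorem sub_eq_cons (S : ℕ → β) {a b : ℕ} (h : a ≤ b) :
    sub S a b = S a :: sub S (a + 1) b := by
  rw [sub, sub, show b + 1 - a = (b + 1 - (a + 1)) + 1 by omega, List.range'_succ, List.map_cons]

theorem sub_congr_shift {a b d e : ℕ} (hl : b + 1 - a = e + 1 - d)
    (h : ∀ t, t < b + 1 - a → S (a + t) = S (d + t)) : sub S a b = sub S d e := by
  apply List.ext_getElem
  · simpa using hl
  · intro t h₁ _
    simpa using h t (by simpa using h₁)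

theorem IsPeriod.apply_add_mod (h : IsPeriod S i j p) (t : ℕ) (ht : i + t ≤ j) :
    S (i + t % p) = S (i + t) := by
  have hp := h.1
  induction t using Nat.strong_induction_on with
  | _ t ih =>
    by_cases htp : t < p
    · rw [Nat.mod_eq_of_lt htp]
    · rw [Nat.mod_eq_sub_mod (by omega), ih (t - p) (by omega) (by omega),
        h.2 (i + (t - p)) (by omega) (by omega)]
      congr 1
      omega

theorem IsPeriod.sub_eq_rotate (h : IsPeriod S i j p) {k : ℕ} (hk : i + k + p ≤ j + 1) :
    sub S (i + k) (i + k + p - 1) = (sub S i (i + p - 1)).rotate k := by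
  have hp := h.1
  have hl : (sub S i (i + p - 1)).length = p := by simp; omega
  apply List.ext_getElem
  · simp
    omega
  · intro t h₁ h₂
    simp only [length_sub] at h₁
    rw [List.getElem_rotate]
    simp only [getElem_sub, hl]
    rw [h.apply_add_mod _ (by omega)]
    congr 1
    omega

theorem IsPeriod.sub_eq_shift (h : IsPeriod S i j p) {a b : ℕ} (ha : i ≤ a) (hb : b + p ≤ j) :
    sub S a b = sub S (a + p) (b + p) :=
  sub_congr_shift (by omega) fun t ht => by
    rw [h.2 (a + t) (by omega) (by omega)]
    congr 1
    omega

theorem IsRun.rotate_ne (h : IsRun S n i j p) {m : ℕ} (hm : 0 < m) (hmp : m < p) :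
    (sub S i (i + p - 1)).rotate m ≠ sub S i (i + p - 1) := by
  obtain ⟨-, -, -, hper, hmin, -⟩ := h
  intro heq
  have hl : (sub S i (i + p - 1)).length = p := by simp; omega
  refine hmin m hm hmp ⟨hm, fun x hx hxm => ?_⟩
  obtain ⟨t, rfl⟩ := Nat.exists_eq_add_of_le hx
  have hlt : t % p < p := Nat.mod_lt _ (by omega)
  have key := List.getElem_of_eq heq.symm (i := t % p) (by rw [hl]; exact hlt)
  rw [List.getElem_rotate] at key
  simp only [getElem_sub, hl, Nat.mod_add_mod] at key
  rwa [hper.apply_add_mod t (by omega), hper.apply_add_mod (t + m) (by omega),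
    ← Nat.add_assoc] at key

end Substring

theorem isLyndon_iff_rotate {l : List α} :
    IsLyndon l ↔ l ≠ [] ∧ ∀ k, 0 < k → k < l.length → l < l.rotate k := by
  unfold IsLyndon
  refine and_congr_right fun _ => forall_congr' fun k => forall_congr' fun _ =>
    forall_congr' fun hk => ?_
  rw [List.rotate_eq_drop_append_take hk.le]
  rfl

/-- A Lyndon word has no non-trivial border. -/
theorem IsLyndon.not_border {d e f : List α} (he : e ≠ []) (hd : d ≠ []) (hf : f ++ d = d ++ e)
    (h : IsLyndon (d ++ e)) : False := by
  have hlen : f.length = e.length := by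
    have := congrArg List.length hf
    simp at this
    omega
  have hep := List.length_pos_iff.mpr he
  have hdp := List.length_pos_iff.mpr hd
  have h₁ : d ++ e < d ++ f := by
    have := h.2 f.length (by omega) (by simp; omega)
    rw [← hf, List.drop_left, List.take_left, hf] at this
    exact this
  have h₂ : f ++ d < e ++ d := by
    have := h.2 d.length (by omega) (by simp; omega)
    rw [List.drop_left, List.take_left, ← hf] at this
    exact this
  rw [List.append_lt_append_left_iff] at h₁
  exact lt_asymm h₂ (List.append_lt_append_of_lt_of_length_eq h₁ hlen.symm _ _)

section Run

variable {S : ℕ → α} {n i j p : ℕ}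

theorem IsRun.exists_isLyndon (h : IsRun S n i j p) :
    ∃ k < p, IsLyndon (sub S (i + k) (i + k + p - 1)) := by
  have hp := h.2.2.2.1.1
  have h2 := h.2.2.2.2.2.1
  have hij := h.2.1
  set L := sub S i (i + p - 1) with hL
  have hl : L.length = p := by simp [hL]; omega
  obtain ⟨k, hk, hmin⟩ := Finset.exists_min_image (Finset.range p) (fun k => L.rotate k)
    ⟨0, Finset.mem_range.mpr hp⟩
  rw [Finset.mem_range] at hk
  refine ⟨k, hk, ?_⟩
  rw [h.2.2.2.1.sub_eq_rotate (by omega), isLyndon_iff_rotate, ← hL]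
  refine ⟨fun h0 => ?_, fun m hm hmp => lt_of_le_of_ne ?_ fun heq => ?_⟩
  · have := congrArg List.length h0
    simp [hl] at this
    omega
  · rw [List.rotate_rotate, ← List.rotate_mod L (k + m), hl]
    exact hmin _ (Finset.mem_range.mpr (Nat.mod_lt _ hp))
  · rw [List.length_rotate, hl] at hmp
    rw [List.rotate_rotate, Nat.add_comm, ← List.rotate_rotate] at heq
    exact h.rotate_ne hm hmp (List.rotate_injective k heq).symm

theorem IsRun.isLyndon_unique (h : IsRun S n i j p) {k m : ℕ} (hkm : k < m) (hm : m < p)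
    (h₁ : IsLyndon (sub S (i + k) (i + k + p - 1)))
    (h₂ : IsLyndon (sub S (i + m) (i + m + p - 1))) : False := by
  have h2 := h.2.2.2.2.2.1
  have hij := h.2.1
  rw [h.2.2.2.1.sub_eq_rotate (by omega), isLyndon_iff_rotate] at h₁ h₂
  set L := sub S i (i + p - 1) with hL
  have hl : L.length = p := by simp [hL]; omega
  simp only [List.length_rotate, hl, List.rotate_rotate] at h₁ h₂
  have a := h₁.2 (m - k) (by omega) (by omega)
  have b := h₂.2 (p - (m - k)) (by omega) (by omega)
  rw [show k + (m - k) = m by omega] at a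
  rw [show m + (p - (m - k)) = k + p by omega, ← List.rotate_mod L (k + p), hl,
    Nat.add_mod_right, Nat.mod_eq_of_lt (by omega)] at b
  exact lt_asymm a b

theorem IsDecRun.apply_lt (h : IsDecRun S n i j p) (hjn : j < n) :
    S (j + 1) < S (j + 1 - p) := by
  obtain ⟨⟨hi, hij, -, hper, -, h2, -, hmax⟩, hdec⟩ := h
  have hp := hper.1
  have hne : S (j + 1 - p) ≠ S (j + 1) := fun heq => hmax hjn ⟨hp, fun x hx hxp => by
    by_cases hxj : x + p ≤ j
    · exact hper.2 x hx hxj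
    · obtain rfl : x = j + 1 - p := by omega
      rw [heq]
      congr 1
      omega⟩
  change sub S (i + p) n < sub S i n at hdec
  rw [sub_eq_append S (a := i + p) (m := j + 1) (by omega) (by omega),
    sub_eq_append S (a := i) (m := j + 1 - p) (by omega) (by omega),
    hper.sub_eq_shift (a := i) le_rfl (by omega),
    show j + 1 - p - 1 + p = j + 1 - 1 by omega,
    List.append_lt_append_left_iff, sub_eq_cons S (show j + 1 ≤ n by omega),
    sub_eq_cons S (show j + 1 - p ≤ n by omega), List.cons_lt_cons_iff] at hdec
  rcases hdec with hd | ⟨hd, -⟩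
  · exact hd
  · exact absurd hd.symm hne

theorem IsDecRun.not_isLyndon (h : IsDecRun S n i j p) {a k : ℕ} (hia : i ≤ a) (hap : a < i + p)
    (hak : a + p ≤ k) (hkn : k ≤ n) : ¬ IsLyndon (sub S a k) := by
  obtain ⟨hi, hij, -, hper, -, h2, -⟩ := h.1
  have hp := hper.1
  intro hL
  by_cases hkj : k ≤ j
  · have e₁ := sub_eq_append S (a := a) (m := k - p + 1) (b := k) (by omega) (by omega)
    have e₂ := sub_eq_append S (a := a) (m := a + p) (b := k) (by omega) (by omega)
    rw [show sub S (a + p) k = sub S a (k - p + 1 - 1) by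
      rw [hper.sub_eq_shift hia (by omega)]
      congr 1
      omega] at e₂
    rw [e₁] at hL e₂
    refine hL.not_border ?_ ?_ e₂.symm <;>
    · rw [← List.length_pos_iff, length_sub]
      omega
  · have hlt := h.apply_lt (by omega)
    have hrot := hL.2 p hp (by simp; omega)
    rw [sub_eq_append S (a := a) (m := a + p) (b := k) (by omega) (by omega)] at hrot
    rw [List.drop_left' (by simp; omega), ← sub_eq_append S (by omega) (by omega),
      sub_eq_append S (a := a + p) (m := j + 1) (b := k) (by omega) (by omega),
      sub_eq_append S (a := a) (m := j + 1 - p) (b := k) (by omega) (by omega),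
      hper.sub_eq_shift hia (by omega), show j + 1 - p - 1 + p = j + 1 - 1 by omega,
      List.append_assoc] at hrot
    change (_ : List α) < _ at hrot
    rw [List.append_lt_append_left_iff, sub_eq_cons S (show j + 1 ≤ k by omega),
      sub_eq_cons S (show j + 1 - p ≤ k by omega), List.cons_append, List.cons_lt_cons_iff] at hrot
    rcases hrot with hd | ⟨hd, -⟩
    · exact lt_asymm hd hlt
    · exact hlt.ne' hd

end Run

theorem isLyndon_sub_of_lyn_eq {S : ℕ → α} {n a p : ℕ} (hp : 0 < p) (h : lyn S n a = p) :
    IsLyndon (sub S a (a + p - 1)) := by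
  have hmem := Nat.sSup_mem
    (s := {m | ∃ j, a ≤ j ∧ j ≤ n ∧ IsLyndon (sub S a j) ∧ m = j - a + 1}) ?_ ?_
  · obtain ⟨k, hak, -, hL, hk⟩ := hmem
    change lyn S n a = _ at hk
    rwa [show a + p - 1 = k by omega]
  · by_contra h0
    rw [Set.not_nonempty_iff_eq_empty] at h0
    rw [lyn, h0, csSup_empty] at h
    exact hp.ne h
  · refine ⟨n + 1, ?_⟩
    rintro m ⟨k, -, hk, -, rfl⟩
    omega

/-- For a decreasing run `(i,j,p)` there is exactly one index
`i0 ∈ [i, i+p)` with `λ[i0] = p`. -/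
theorem stmt_3 (S : ℕ → α) (n i j p : ℕ) (h : IsDecRun S n i j p) :
    ∃! i0, (i ≤ i0 ∧ i0 < i + p) ∧ lyn S n i0 = p := by
  have hp := h.1.2.2.2.1.1
  have h2 := h.1.2.2.2.2.2.1
  have hij := h.1.2.1
  have hjn := h.1.2.2.1
  obtain ⟨k, hk, hL⟩ := h.1.exists_isLyndon
  refine ⟨i + k, ⟨⟨by omega, by omega⟩, IsGreatest.csSup_eq ⟨?_, ?_⟩⟩, ?_⟩
  · exact ⟨i + k + p - 1, by omega, by omega, hL, by omega⟩
  · rintro m ⟨b, hb, hbn, hLb, rfl⟩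
    by_contra hlt
    exact h.not_isLyndon (by omega) (by omega) (by omega) hbn hLb
  · rintro a ⟨⟨hia, hap⟩, hlyn⟩
    obtain ⟨m, rfl⟩ := Nat.exists_eq_add_of_le hia
    have hLm := isLyndon_sub_of_lyn_eq hp hlyn
    rcases lt_trichotomy m k with hmk | rfl | hmk
    · exact (h.1.isLyndon_unique hmk hk hLm hL).elim
    · rfl
    · exact (h.1.isLyndon_unique hmk (by omega) hL hLm).elim
end

section
/- Let S be a string of length n and let i, i', j, j' ∈ [1,n] satisfy nss(i) = j, nss(i') = j', i < i', j' ≤ j, and j < j' + rlce(i', j'). Then rlce(i,j) ≥ rlce(i', j') − (j − j'). -/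
open List

variable {α : Type*} [LinearOrder α]

theorem le_lcpLen_iff (l₁ l₂ : List α) (m : ℕ) :
    m ≤ lcpLen l₁ l₂ ↔ m ≤ l₁.length ∧ m ≤ l₂.length ∧ l₁.take m = l₂.take m := by
  unfold lcpLen
  constructor
  · intro h
    have hle := Nat.findGreatest_le (P := fun k => l₁.take k = l₂.take k)
      (min l₁.length l₂.length)
    have heq := Nat.findGreatest_spec (P := fun k => l₁.take k = l₂.take k)
      (Nat.zero_le (min l₁.length l₂.length)) (by simp)
    refine ⟨by omega, by omega, ?_⟩
    have := congrArg (List.take m) heq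
    simpa only [List.take_take, min_eq_left h] using this
  · rintro ⟨ha, hb, h⟩
    exact Nat.le_findGreatest (le_min ha hb) h

/-- A string lying lexicographically between two strings with a common prefix of length `m`
shares that prefix. -/
theorem take_eq_of_slt_of_not_slt (m : ℕ) {a b c : List α} (ha : m ≤ a.length)
    (hc : m ≤ c.length) (hac : a.take m = c.take m) (hab : slt a b) (hcb : ¬ slt c b) :
    m ≤ b.length ∧ b.take m = a.take m := by
  induction m generalizing a b c with
  | zero => simp
  | succ m ih =>
    cases hab with
    | nil => simp at ha
    | @rel x a y b hxy =>
      cases c with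
      | nil => simp at hc
      | cons z c =>
        simp only [List.take_succ_cons, List.cons.injEq] at hac
        obtain ⟨rfl, -⟩ := hac
        exact absurd (List.Lex.rel hxy) hcb
    | @cons x a b hab =>
      cases c with
      | nil => simp at hc
      | cons z c =>
        simp only [List.take_succ_cons, List.cons.injEq] at hac
        obtain ⟨rfl, hac⟩ := hac
        simp only [List.length_cons, Nat.add_le_add_iff_right] at ha hc
        have := ih ha hc hac hab fun h => hcb (List.Lex.cons h)
        simpa using this

theorem drop_suf {β : Type*} (S : ℕ → β) (n i d : ℕ) : (suf S n i).drop d = suf S n (i + d) := by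
  simp only [suf, sub, ← List.map_drop, List.drop_range', mul_one]
  congr 2
  omega

theorem rlce_sub_le_rlce_add (S : ℕ → α) (n i j d : ℕ) :
    rlce S n i j - d ≤ rlce S n (i + d) (j + d) := by
  obtain ⟨hi, hj, h⟩ := (le_lcpLen_iff (suf S n i) (suf S n j) _).1 le_rfl
  refine (le_lcpLen_iff _ _ _).2 ?_
  rw [← drop_suf, ← drop_suf]
  refine ⟨?_, ?_, ?_⟩
  · rw [List.length_drop]
    exact Nat.sub_le_sub_right hi d
  · rw [List.length_drop]
    exact Nat.sub_le_sub_right hj d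
  · have := congrArg (List.drop d) h
    rwa [List.drop_take, List.drop_take] at this

theorem nss_spec {S : ℕ → α} {n i : ℕ} (h : nss S n i ≤ n) :
    i < nss S n i ∧ slt (suf S n (nss S n i)) (suf S n i) := by
  have hmem : nss S n i ∈ {j | j = n + 1 ∨ (i < j ∧ j ≤ n ∧ slt (suf S n j) (suf S n i))} :=
    Nat.sInf_mem ⟨n + 1, Or.inl rfl⟩
  rcases hmem with h' | ⟨hlt, -, hs⟩
  · omega
  · exact ⟨hlt, hs⟩

theorem not_slt_of_lt_nss {S : ℕ → α} {n i k : ℕ} (hik : i < k) (hkn : k ≤ n)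
    (hk : k < nss S n i) : ¬ slt (suf S n k) (suf S n i) := fun hs =>
  Nat.notMem_of_lt_sInf hk (Or.inr ⟨hik, hkn, hs⟩)

/-- If `S_j ≺ S_i` and `S_k` is not smaller than `S_i`, then `S_i` agrees with `S_j` at least as
far as `S_k` does. -/
theorem rlce_le_rlce_of_slt {S : ℕ → α} {n i j k : ℕ} (hj : slt (suf S n j) (suf S n i))
    (hk : ¬ slt (suf S n k) (suf S n i)) : rlce S n k j ≤ rlce S n i j := by
  obtain ⟨hc, ha, h⟩ := (le_lcpLen_iff (suf S n k) (suf S n j) _).1 le_rfl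
  obtain ⟨hb, hba⟩ := take_eq_of_slt_of_not_slt _ ha hc h.symm hj hk
  exact (le_lcpLen_iff _ _ _).2 ⟨hb, ha, hba⟩

/-- Case R1: If `nss(i) = j`, `nss(i') = j'`, `i < i'`, `j' ≤ j`, and
`j < j' + rlce(i',j')`, then `rlce(i,j) ≥ rlce(i',j') - (j - j')`. -/
theorem stmt_10 (S : ℕ → α) (n i j i' j' : ℕ)
    (hi1 : 1 ≤ i) (hi2 : i ≤ n) (hj1 : 1 ≤ j) (hj2 : j ≤ n)
    (hi'1 : 1 ≤ i') (hi'2 : i' ≤ n) (hj'1 : 1 ≤ j') (hj'2 : j' ≤ n)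
    (h1 : nss S n i = j) (h2 : nss S n i' = j')
    (h3 : i < i') (h4 : j' ≤ j) (h5 : j < j' + rlce S n i' j') :
    rlce S n i' j' - (j - j') ≤ rlce S n i j := by
  obtain ⟨d, rfl⟩ := Nat.exists_eq_add_of_le h4
  have hij := nss_spec (h1.trans_le hj2)
  have hij' := nss_spec (h2.trans_le hj'2)
  rw [h1] at hij
  rw [h2] at hij'
  have hk : ¬ slt (suf S n (i' + d)) (suf S n i) :=
    not_slt_of_lt_nss (by omega) (by omega) (by omega)
  rw [Nat.add_sub_cancel_left]
  exact (rlce_sub_le_rlce_add S n i' j' d).trans (rlce_le_rlce_of_slt hij.2 hk)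
end

section
/- Let S be a string of length n, let nss(i') = j' with j' ≤ n, let ℓ' = rlce(i', j') and d = j' − i'. Let i, j ∈ [1,n] satisfy nss(i) = j, j' < i, and j < j' + ℓ'. If nss(i − d) = j − d and (j − d) + rlce(i − d, j − d) < i' + ℓ', then rlce(i,j) = rlce(i − d, j − d). -/
open List

variable {α : Type*} [LinearOrder α]

theorem length_suf (S : ℕ → α) (n i : ℕ) : (suf S n i).length = n + 1 - i := by
  simp [suf, sub]

theorem take_suf_eq_iff (S : ℕ → α) {n a b m : ℕ} (ha : m ≤ n + 1 - a) (hb : m ≤ n + 1 - b) :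
    (suf S n a).take m = (suf S n b).take m ↔ ∀ t < m, S (a + t) = S (b + t) := by
  constructor
  · intro h t ht
    have := congrArg (fun l : List α => l[t]?) h
    have h1 : t < n + 1 - a := by omega
    have h2 : t < n + 1 - b := by omega
    simpa [suf, sub, ht, h1, h2, List.getElem?_range'] using this
  · intro h
    apply List.ext_getElem
    · simp [length_suf]; omega
    · intro t h1 h2
      simp only [List.length_take, length_suf] at h1
      simpa [suf, sub] using h t (by omega)

theorem rlce_le (S : ℕ → α) (n a b : ℕ) :
    rlce S n a b ≤ n + 1 - a ∧ rlce S n a b ≤ n + 1 - b := by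
  have h : rlce S n a b ≤ min (suf S n a).length (suf S n b).length := Nat.findGreatest_le _
  simpa [length_suf] using h

theorem eq_of_lt_rlce (S : ℕ → α) {n a b t : ℕ} (ht : t < rlce S n a b) :
    S (a + t) = S (b + t) := by
  have h : (suf S n a).take (rlce S n a b) = (suf S n b).take (rlce S n a b) :=
    Nat.findGreatest_spec (P := fun k => (suf S n a).take k = (suf S n b).take k)
      (Nat.zero_le _) (by simp)
  exact (take_suf_eq_iff S (rlce_le S n a b).1 (rlce_le S n a b).2).1 h t ht

theorem le_rlce (S : ℕ → α) {n a b m : ℕ} (ha : m ≤ n + 1 - a) (hb : m ≤ n + 1 - b)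
    (h : ∀ t < m, S (a + t) = S (b + t)) : m ≤ rlce S n a b :=
  Nat.le_findGreatest (by simp [length_suf]; omega) ((take_suf_eq_iff S ha hb).2 h)

theorem ne_at_rlce (S : ℕ → α) {n a b : ℕ} (ha : a + rlce S n a b ≤ n)
    (hb : b + rlce S n a b ≤ n) : S (a + rlce S n a b) ≠ S (b + rlce S n a b) := by
  intro h
  have := le_rlce S (n := n) (a := a) (b := b) (m := rlce S n a b + 1) (by omega) (by omega) (by
    intro t ht
    rcases Nat.lt_succ_iff_lt_or_eq.1 ht with h' | rfl
    · exact eq_of_lt_rlce S h'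
    · exact h)
  omega

theorem lt_nss_of_nss_le (S : ℕ → α) {n i : ℕ} (h : nss S n i ≤ n) : i < nss S n i := by
  have hm : nss S n i ∈ {j | j = n + 1 ∨ (i < j ∧ j ≤ n ∧ slt (suf S n j) (suf S n i))} :=
    Nat.sInf_mem ⟨n + 1, Or.inl rfl⟩
  rcases hm with hm | hm
  · omega
  · exact hm.1

/-- Case R3b: With `nss(i') = j' ≤ n`, `ℓ' = rlce(i',j')`, `d = j' - i'`,
`nss(i) = j`, `j' < i`, `j < j' + ℓ'`: if `nss(i - d) = j - d` and
`(j - d) + rlce(i - d, j - d) < i' + ℓ'`, then `rlce(i,j) = rlce(i - d, j - d)`. -/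
theorem stmt_13 (S : ℕ → α) (n i' j' ℓ' d i j : ℕ)
    (hi'1 : 1 ≤ i') (h1 : nss S n i' = j') (h2 : j' ≤ n)
    (hl : ℓ' = rlce S n i' j') (hd : d = j' - i')
    (hi1 : 1 ≤ i) (hi2 : i ≤ n) (hj1 : 1 ≤ j) (hj2 : j ≤ n)
    (h3 : nss S n i = j) (h4 : j' < i) (h5 : j < j' + ℓ')
    (h6 : nss S n (i - d) = j - d)
    (h7 : (j - d) + rlce S n (i - d) (j - d) < i' + ℓ') :
    rlce S n i j = rlce S n (i - d) (j - d) := by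
  have hij' : i' < j' := h1 ▸ lt_nss_of_nss_le S (h1 ▸ h2)
  have hij : i < j := h3 ▸ lt_nss_of_nss_le S (h3 ▸ hj2)
  have hle := rlce_le S n i' j'
  have hle2 := rlce_le S n (i - d) (j - d)
  have shift : ∀ x, j' ≤ x → x < j' + ℓ' → S (x - d) = S x := by
    intro x hx hx'
    have h := eq_of_lt_rlce S (n := n) (a := i') (b := j') (t := x - j') (by omega)
    rwa [show i' + (x - j') = x - d by omega, show j' + (x - j') = x by omega] at h
  have shift_add : ∀ x t, i ≤ x → x ≤ j → t ≤ rlce S n (i - d) (j - d) →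
      S (x - d + t) = S (x + t) := by
    intro x t hx hx' ht
    rw [← shift (x + t) (by omega) (by omega)]
    congr 1
    omega
  apply le_antisymm
  · by_contra! hlt
    have hne := ne_at_rlce S (n := n) (a := i - d) (b := j - d) (by omega) (by omega)
    rw [shift_add i _ le_rfl hij.le le_rfl, shift_add j _ hij.le le_rfl le_rfl] at hne
    exact hne (eq_of_lt_rlce S hlt)
  · apply le_rlce S (by omega) (by omega)
    intro t ht
    rw [← shift_add i t le_rfl hij.le ht.le, ← shift_add j t hij.le le_rfl ht.le]
    exact eq_of_lt_rlce S ht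
end
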